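/- (Copy rewrite preserves Pauli flow) Let (G,I,O,λ) be a labelled open graph with a vertex u ∉ I∪O with λ(u) = Z (i.e. measured in the Z basis) and let G' be the graph obtained by deleting u (and its incident edges). If G with labelling λ has Pauli flow, then G' with the restricted labelling has Pauli flow. -/

import Mathlib

open scoped Classical

/-- Measurement labels: planes XY, XZ, YZ and Pauli bases X, Y, Z. -/
inductive MeasLabel : Type
  | XY | XZ | YZ | X | Y | Z
  deriving DecidableEq

/-- The odd neighbourhood `Odd(K) = {u : |N(u) ∩ K| odd}` of a set of vertices. -/
noncomputable def oddNbhd {V : Type*} [Fintype V] (G : SimpleGraph V) (K : Finset V) :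
    Finset V :=
  Finset.univ.filter fun u => Odd (K.filter fun w => G.Adj u w).card

/-- `(p, lt)` is a Pauli flow for the labelled open graph `(G, I, O, lam)`:
`lt` is a strict partial order and conditions 1–9 of the definition of Pauli
flow hold for every non-output vertex (with `p v ⊆ V ∖ I`). -/
noncomputable def IsPauliFlow {V : Type*} [Fintype V] (G : SimpleGraph V)
    (I O : Finset V) (lam : V → MeasLabel) (p : V → Finset V)
    (lt : V → V → Prop) : Prop :=
  (∀ v, ¬ lt v v) ∧ (∀ a b c, lt a b → lt b c → lt a c) ∧
  ∀ v, v ∉ O →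
    ((∀ w ∈ p v, w ∉ I) ∧
     (∀ w ∈ p v, lam w ≠ .X → lam w ≠ .Y → v ≠ w → lt v w) ∧
     (∀ w ∈ oddNbhd G (p v), lam w ≠ .Y → lam w ≠ .Z → v ≠ w → lt v w) ∧
     (∀ w, (lt w v ∨ w = v) → lam w = .Y → v ≠ w →
        (w ∈ p v ↔ w ∈ oddNbhd G (p v))) ∧
     (lam v = .XY → v ∉ p v ∧ v ∈ oddNbhd G (p v)) ∧
     (lam v = .XZ → v ∈ p v ∧ v ∈ oddNbhd G (p v)) ∧
     (lam v = .YZ → v ∈ p v ∧ v ∉ oddNbhd G (p v)) ∧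
     (lam v = .X → v ∈ oddNbhd G (p v)) ∧
     (lam v = .Z → v ∈ p v) ∧
     (lam v = .Y →
        ((v ∉ p v ∧ v ∈ oddNbhd G (p v)) ∨ (v ∈ p v ∧ v ∉ oddNbhd G (p v)))))

/-- A labelled open graph has Pauli flow if some `(p, lt)` is a Pauli flow. -/
noncomputable def HasPauliFlow {V : Type*} [Fintype V] (G : SimpleGraph V)
    (I O : Finset V) (lam : V → MeasLabel) : Prop :=
  ∃ p lt, IsPauliFlow G I O lam p lt

theorem Finset.odd_card_symmDiff {α : Type*} (A B : Finset α) :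
    Odd (symmDiff A B).card ↔ ¬ (Odd A.card ↔ Odd B.card) := by
  have hA := Finset.card_sdiff_add_card_inter A B
  have hB := Finset.card_sdiff_add_card_inter B A
  have hAB : (symmDiff A B).card = (A \ B).card + (B \ A).card :=
    Finset.card_union_of_disjoint disjoint_sdiff_sdiff
  rw [Finset.inter_comm] at hB
  simp only [Nat.odd_iff]
  omega

theorem mem_oddNbhd {V : Type*} [Fintype V] {G : SimpleGraph V} {K : Finset V} {w : V} :
    w ∈ oddNbhd G K ↔ Odd (K.filter fun x => G.Adj w x).card := by
  simp [oddNbhd]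

theorem mem_oddNbhd_symmDiff {V : Type*} [Fintype V] {G : SimpleGraph V} {K L : Finset V}
    {w : V} :
    w ∈ oddNbhd G (symmDiff K L) ↔ ¬ (w ∈ oddNbhd G K ↔ w ∈ oddNbhd G L) := by
  simp only [mem_oddNbhd]
  rw [← Finset.odd_card_symmDiff]
  congr! 2
  ext x
  simp only [Finset.mem_filter, Finset.mem_symmDiff]
  tauto

/-- Inducing on a set of vertices containing `K` restricts the odd neighbourhood of `K`. -/
theorem mem_oddNbhd_induce {V : Type*} [Fintype V] {G : SimpleGraph V} {s : Set V}
    [Fintype s] {K : Finset V} (hK : ∀ x ∈ K, x ∈ s) {w : s} :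
    w ∈ oddNbhd (G.induce s) (K.subtype (· ∈ s)) ↔ (w : V) ∈ oddNbhd G K := by
  simp only [mem_oddNbhd]
  rw [← Finset.card_map (Function.Embedding.subtype (· ∈ s))]
  congr! 2
  ext x
  simp only [Finset.mem_map, Finset.mem_filter, Finset.mem_subtype, SimpleGraph.comap_adj,
    Function.Embedding.subtype_apply]
  constructor
  · rintro ⟨a, ha, rfl⟩
    exact ha
  · rintro ⟨hx, hadj⟩
    exact ⟨⟨x, hK x hx⟩, ⟨hx, hadj⟩, rfl⟩

/-- Correction sets avoiding `u`: wherever `u` is used, add the correction set of `u`. -/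
noncomputable def eliminateVertex {V : Type*} (p : V → Finset V) (u v : V) : Finset V :=
  if u ∈ p v then symmDiff (p v) (p u) else p v

theorem notMem_eliminateVertex {V : Type*} {p : V → Finset V} {u : V} (hu : u ∈ p u) (v : V) :
    u ∉ eliminateVertex p u v := by
  unfold eliminateVertex
  split_ifs with h <;> simp [Finset.mem_symmDiff, h, hu]

/-- Pauli flow restricts to the complement of a `Z`-measured internal vertex, described as any set
`s` with the right membership. -/
theorem HasPauliFlow.induce_ne {V : Type*} [Fintype V] {G : SimpleGraph V} {I O : Finset V}
    {lam : V → MeasLabel} {u : V} (hu : u ∉ I ∪ O) (hZ : lam u = .Z)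
    (h : HasPauliFlow G I O lam) {s : Set V} [Fintype s] (hs : ∀ x, x ∈ s ↔ x ≠ u)
    {I' O' : Finset s} (hI' : ∀ w : s, w ∈ I' ↔ (w : V) ∈ I)
    (hO' : ∀ w : s, w ∈ O' ↔ (w : V) ∈ O) :
    HasPauliFlow (G.induce s) I' O' (fun w => lam w) := by
  obtain ⟨p, lt, hirr, htrans, hp⟩ := h
  rw [Finset.mem_union, not_or] at hu
  obtain ⟨huI, hu2, hu3, hu4, -, -, -, -, huZ, -⟩ := hp u hu.2
  have huu := huZ hZ
  have hodd (v : V) (w : s) :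
      w ∈ oddNbhd (G.induce s) ((eliminateVertex p u v).subtype (· ∈ s)) ↔
        (w : V) ∈ oddNbhd G (eliminateVertex p u v) := by
    refine mem_oddNbhd_induce fun x hx => (hs x).mpr ?_
    rintro rfl
    exact notMem_eliminateVertex huu v hx
  refine ⟨fun v => (eliminateVertex p u v).subtype (· ∈ s), fun a b => lt a b,
    fun v => hirr v, fun a b c => htrans a b c, ?_⟩
  rintro ⟨v, hvs⟩ hvO
  have hvu := (hs v).mp hvs
  rw [hO'] at hvO
  obtain ⟨h1, h2, h3, h4, h5, h6, h7, h8, h9, h10⟩ := hp v hvO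
  simp only [hodd, hI', hs, Finset.mem_subtype, Subtype.forall, Subtype.mk.injEq, ne_eq]
  unfold eliminateVertex
  split_ifs with huv
  · have hlt : lt v u := h2 u huv (by simp [hZ]) (by simp [hZ]) hvu
    have hnlt : ¬ lt u v := fun h => hirr v (htrans _ _ _ hlt h)
    simp only [mem_oddNbhd_symmDiff, Finset.mem_symmDiff]
    have hpu (hX : lam v ≠ .X) (hY : lam v ≠ .Y) : v ∉ p u :=
      fun hv => hnlt (hu2 v hv hX hY (Ne.symm hvu))
    have hou (hY : lam v ≠ .Y) (hZ' : lam v ≠ .Z) : v ∉ oddNbhd G (p u) :=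
      fun hv => hnlt (hu3 v hv hY hZ' (Ne.symm hvu))
    refine ⟨?_, ?_, ?_, ?_, ?_, ?_, ?_, ?_, ?_, ?_⟩
    · intro w _ hw
      exact hw.elim (fun h => h1 w h.1) (fun h => huI w h.1)
    · intro w hwu hw hX hY hvw
      by_cases hwv : w ∈ p v
      · exact h2 w hwv hX hY hvw
      · exact htrans _ _ _ hlt (hu2 w (hw.resolve_left fun h => hwv h.1).1 hX hY (Ne.symm hwu))
    · intro w hwu hw hY hZ' hvw
      by_cases hwv : w ∈ oddNbhd G (p v)
      · exact h3 w hwv hY hZ' hvw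
      · exact htrans _ _ _ hlt (hu3 w (by simpa [hwv] using hw) hY hZ' (Ne.symm hwu))
    · intro w hwu hw hY hvw
      have hwv : lt w v := hw.resolve_right (Ne.symm hvw)
      have e1 := h4 w (Or.inl hwv) hY hvw
      have e2 := hu4 w (Or.inl (htrans _ _ _ hwv hlt)) hY (Ne.symm hwu)
      clear * - e1 e2
      tauto
    · intro hv
      have hv' := h5 hv
      have hpv := hpu (by simp [hv]) (by simp [hv])
      have hov := hou (by simp [hv]) (by simp [hv])
      clear * - hv' hpv hov
      tauto
    · intro hv
      have hv' := h6 hv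
      have hpv := hpu (by simp [hv]) (by simp [hv])
      have hov := hou (by simp [hv]) (by simp [hv])
      clear * - hv' hpv hov
      tauto
    · intro hv
      have hv' := h7 hv
      have hpv := hpu (by simp [hv]) (by simp [hv])
      have hov := hou (by simp [hv]) (by simp [hv])
      clear * - hv' hpv hov
      tauto
    · intro hv hiff
      exact hou (by simp [hv]) (by simp [hv]) (hiff.mp (h8 hv))
    · intro hv
      exact Or.inl ⟨h9 hv, hpu (by simp [hv]) (by simp [hv])⟩
    · intro hv
      have hcases := h10 hv
      have hiff := hu4 v (Or.inl hlt) hv (Ne.symm hvu)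
      clear * - hcases hiff
      tauto
  · exact ⟨fun w _ => h1 w, fun w _ => h2 w, fun w _ => h3 w, fun w _ => h4 w,
      h5, h6, h7, h8, h9, h10⟩

/-- Copy rewrite preserves Pauli flow: deleting a Z-measured internal vertex
`u ∉ I ∪ O` (together with its incident edges) from a labelled open graph with
Pauli flow yields a labelled open graph with Pauli flow. -/
theorem deleteZ_preserves_pauliFlow {V : Type*} [Fintype V]
    (G : SimpleGraph V) (I O : Finset V) (lam : V → MeasLabel)
    (u : V) (hu : u ∉ I ∪ O) (hZ : lam u = .Z)
    (h : HasPauliFlow G I O lam) :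
    HasPauliFlow (G.induce {w | w ≠ u})
      (Finset.univ.filter fun w : {w : V // w ≠ u} => (w : V) ∈ I)
      (Finset.univ.filter fun w : {w : V // w ≠ u} => (w : V) ∈ O)
      (fun w => lam (w : V)) := by
  refine h.induce_ne hu hZ (s := {w | w ≠ u}) (fun _ => Iff.rfl) ?_ ?_ <;>
    exact fun _ => Finset.mem_filter_univ _
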